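/- arXiv:1603.05621 — 4 statements merged into one kernel-verified Lean document; each statement's English description precedes it below -/
import Mathlib

section
/- Let A be an order-k real tensor with dimensions (d₁,…,d_k) and let 1 ≤ p ≤ q ≤ ∞ (with the convention 1/∞ = 0). Then ‖A‖_p ≤ ‖A‖_q ≤ dim(A)^{1/p − 1/q} · ‖A‖_p. -/
open scoped BigOperators ENNReal

namespace TensorUnfolding

/-- The vector `l^p` norm of a finitely-indexed real vector, for `p ∈ [1, ∞]`
(for `p = ∞` it is the maximum of the absolute values of the entries). -/
noncomputable def pNorm (p : ℝ≥0∞) {ι : Type} [Fintype ι] (x : ι → ℝ) : ℝ :=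
  if p = ⊤ then ⨆ i, |x i| else (∑ i, |x i| ^ p.toReal) ^ (1 / p.toReal)

/-- `π` is a partition of `[k] = {0, …, k-1}`: a collection of disjoint nonempty
blocks whose union is all of `Fin k`. -/
def IsPartition {k : ℕ} (π : Finset (Finset (Fin k))) : Prop :=
  (∀ B ∈ π, B.Nonempty) ∧
  (∀ B ∈ π, ∀ B' ∈ π, B ≠ B' → Disjoint B B') ∧
  π.sup id = Finset.univ

/-- `π₁ ≤ π₂`: every block of `π₁` is contained in some block of `π₂`. -/
def Refines {k : ℕ} (π₁ π₂ : Finset (Finset (Fin k))) : Prop :=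
  ∀ B ∈ π₁, ∃ B' ∈ π₂, B ⊆ B'

/-- The finest partition `0_{[k]} = {{1}, …, {k}}`. -/
def botPartition (k : ℕ) : Finset (Finset (Fin k)) :=
  Finset.univ.image fun n => {n}

/-- The coarsest (one-block) partition `1_{[k]} = {[k]}`. -/
def topPartition (k : ℕ) : Finset (Finset (Fin k)) :=
  {Finset.univ}

/-- The meet `π₁ ∧ π₂`: the partition whose blocks are the nonempty
intersections `B ∩ B'` with `B ∈ π₁`, `B' ∈ π₂`. -/
def meetPartition {k : ℕ} (π₁ π₂ : Finset (Finset (Fin k))) : Finset (Finset (Fin k)) :=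
  ((π₁ ×ˢ π₂).image fun p => p.1 ∩ p.2).filter fun B => B.Nonempty

/-- The `l^p` operator norm of the unfolding of the tensor `A` induced by the
partition `π`: the supremum of `⟨A, ⊗_{B ∈ π} y_B⟩` over choices, for each block
`B ∈ π`, of a vector `y_B` indexed by `Π_{j ∈ B} Fin (d j)` with `l^p` norm 1. -/
noncomputable def unfoldNormP {k : ℕ} (p : ℝ≥0∞) (d : Fin k → ℕ)
    (A : ((n : Fin k) → Fin (d n)) → ℝ) (π : Finset (Finset (Fin k))) : ℝ :=
  sSup { r : ℝ |
    ∃ y : (B : Finset (Fin k)) → ((j : B) → Fin (d j.1)) → ℝ,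
      (∀ B ∈ π, pNorm p (y B) = 1) ∧
      r = ∑ i : (n : Fin k) → Fin (d n), A i * ∏ B ∈ π, y B fun j => i j.1 }

/-- The spectral norm of the unfolding of the tensor `A` induced by the
partition `π`: the supremum of `⟨A, ⊗_{B ∈ π} y_B⟩` over choices, for each block
`B ∈ π`, of a vector `y_B` indexed by `Π_{j ∈ B} Fin (d j)` with Euclidean norm 1. -/
noncomputable def unfoldNorm {k : ℕ} (d : Fin k → ℕ)
    (A : ((n : Fin k) → Fin (d n)) → ℝ) (π : Finset (Finset (Fin k))) : ℝ :=
  sSup { r : ℝ |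
    ∃ y : (B : Finset (Fin k)) → ((j : B) → Fin (d j.1)) → ℝ,
      (∀ B ∈ π, ∑ v, (y B v) ^ 2 = 1) ∧
      r = ∑ i : (n : Fin k) → Fin (d n), A i * ∏ B ∈ π, y B fun j => i j.1 }

/-- The `l^p` operator norm of the tensor `A`:
`‖A‖_p = sup { A(x₁, …, x_k) : ‖x_n‖_p = 1 }`. -/
noncomputable def opNormP {k : ℕ} (p : ℝ≥0∞) (d : Fin k → ℕ)
    (A : ((n : Fin k) → Fin (d n)) → ℝ) : ℝ :=
  sSup { r : ℝ | ∃ x : (n : Fin k) → Fin (d n) → ℝ,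
    (∀ n, pNorm p (x n) = 1) ∧
    r = ∑ i : (n : Fin k) → Fin (d n), A i * ∏ n, x n (i n) }

/-- The spectral norm of the tensor `A`:
`‖A‖_σ = sup { A(x₁, …, x_k) : ‖x_n‖₂ = 1 }`. -/
noncomputable def specNorm {k : ℕ} (d : Fin k → ℕ)
    (A : ((n : Fin k) → Fin (d n)) → ℝ) : ℝ :=
  sSup { r : ℝ | ∃ x : (n : Fin k) → Fin (d n) → ℝ,
    (∀ n, ∑ i, (x n i) ^ 2 = 1) ∧
    r = ∑ i : (n : Fin k) → Fin (d n), A i * ∏ n, x n (i n) }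

/-- The Frobenius norm of the tensor `A`. -/
noncomputable def frobNorm {k : ℕ} (d : Fin k → ℕ)
    (A : ((n : Fin k) → Fin (d n)) → ℝ) : ℝ :=
  Real.sqrt (∑ i : (n : Fin k) → Fin (d n), (A i) ^ 2)

/-- `D_A(B, B') = Π_{n ∈ B ∩ B'} d_n` if `B ∩ B' ≠ ∅`, and `0` otherwise. -/
def blockDim {k : ℕ} (d : Fin k → ℕ) (B B' : Finset (Fin k)) : ℕ :=
  if (B ∩ B').Nonempty then ∏ n ∈ B ∩ B', d n else 0

/-- `dim_A(π₁, π₂) = Π_{B ∈ π₁} max_{B' ∈ π₂} D_A(B, B')`. -/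
def dimRel {k : ℕ} (d : Fin k → ℕ) (π₁ π₂ : Finset (Finset (Fin k))) : ℕ :=
  ∏ B ∈ π₁, π₂.sup fun B' => blockDim d B B'

/-- `A` is `π`-orthogonal decomposable: `A = Σ_{n=1}^r λ_n a₁⁽ⁿ⁾ ⊗ ⋯ ⊗ a_k⁽ⁿ⁾`
with `λ₁ ≥ ⋯ ≥ λ_r ≥ 0` and `Π_{i ∈ B} ⟨a_i⁽ⁿ⁾, a_i⁽ᵐ⁾⟩ = δ_{nm}` for every
block `B ∈ π`. -/
def IsPiOD {k : ℕ} (d : Fin k → ℕ) (A : ((n : Fin k) → Fin (d n)) → ℝ)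
    (π : Finset (Finset (Fin k))) : Prop :=
  ∃ (r : ℕ) (lam : Fin r → ℝ) (a : Fin r → (n : Fin k) → Fin (d n) → ℝ),
    Antitone lam ∧ (∀ n, 0 ≤ lam n) ∧
    (∀ i, A i = ∑ n, lam n * ∏ m, a n m (i m)) ∧
    (∀ B ∈ π, ∀ n m : Fin r,
      (∏ j ∈ B, ∑ t, a n j t * a m j t) = if n = m then 1 else 0)

end TensorUnfolding

namespace TensorUnfolding

section pNorm

variable {ι : Type} [Fintype ι] {p q : ℝ≥0∞} {x : ι → ℝ}

theorem pNorm_eq_norm_toLp [Fact (1 ≤ p)] (x : ι → ℝ) :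
    pNorm p x = ‖WithLp.toLp p x‖ := by
  unfold pNorm
  split_ifs with h
  · subst h
    simp [PiLp.norm_eq_ciSup]
  · have hp : 0 < p.toReal :=
      ENNReal.toReal_pos (zero_lt_one.trans_le Fact.out).ne' h
    simp [PiLp.norm_eq_sum hp]

theorem pNorm_smul (hp : 1 ≤ p) (c : ℝ) (x : ι → ℝ) :
    pNorm p (c • x) = |c| * pNorm p x := by
  have : Fact (1 ≤ p) := ⟨hp⟩
  simp only [pNorm_eq_norm_toLp, WithLp.toLp_smul, norm_smul, Real.norm_eq_abs]

theorem pNorm_pos (hp : 1 ≤ p) (hx : x ≠ 0) : 0 < pNorm p x := by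
  have : Fact (1 ≤ p) := ⟨hp⟩
  rw [pNorm_eq_norm_toLp, norm_pos_iff]
  simpa using hx

theorem abs_apply_le_pNorm (hp : 1 ≤ p) (x : ι → ℝ) (i : ι) : |x i| ≤ pNorm p x := by
  have : Fact (1 ≤ p) := ⟨hp⟩
  rw [pNorm_eq_norm_toLp]
  exact PiLp.norm_apply_le (WithLp.toLp p x) i

theorem ne_zero_of_pNorm_eq_one (hp : 1 ≤ p) (hx : pNorm p x = 1) : x ≠ 0 := by
  have : Fact (1 ≤ p) := ⟨hp⟩
  rintro rfl
  simp [pNorm_eq_norm_toLp] at hx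

theorem sum_rpow_eq_one (hp : 1 ≤ p) (hpt : p ≠ ⊤) (hx : pNorm p x = 1) :
    ∑ i, |x i| ^ p.toReal = 1 := by
  have hp0 : 0 < p.toReal := ENNReal.toReal_pos (zero_lt_one.trans_le hp).ne' hpt
  rw [pNorm, if_neg hpt] at hx
  rw [← Real.one_rpow p.toReal, ← hx, ← Real.rpow_mul (by positivity),
    one_div_mul_cancel hp0.ne', Real.rpow_one]

theorem pNorm_le_one_of_le (hp : 1 ≤ p) (hpq : p ≤ q) (hx : pNorm p x = 1) :
    pNorm q x ≤ 1 := by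
  have hle (i : ι) : |x i| ≤ 1 := (abs_apply_le_pNorm hp x i).trans hx.le
  unfold pNorm
  split_ifs with hq
  · exact Real.iSup_le hle zero_le_one
  · have hpt : p ≠ ⊤ := ne_top_of_le_ne_top hq hpq
    have hp0 : 0 < p.toReal := ENNReal.toReal_pos (zero_lt_one.trans_le hp).ne' hpt
    refine Real.rpow_le_one (by positivity) ?_ (by positivity)
    rw [← sum_rpow_eq_one hp hpt hx]
    exact Finset.sum_le_sum fun i _ =>
      Real.rpow_le_rpow_of_exponent_ge' (abs_nonneg _) (hle i) hp0.le (ENNReal.toReal_mono hq hpq)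

theorem pNorm_le_card_rpow (hp : 1 ≤ p) (hpq : p ≤ q) (hx : pNorm q x = 1) :
    pNorm p x ≤ (Fintype.card ι : ℝ) ^ (1 / p - 1 / q).toReal := by
  have hq1 := hp.trans hpq
  rcases eq_or_ne p ⊤ with rfl | hpt
  · obtain rfl : q = ⊤ := top_le_iff.mp hpq
    simp [hx]
  have hp0 : 0 < p.toReal := ENNReal.toReal_pos (zero_lt_one.trans_le hp).ne' hpt
  rw [pNorm, if_neg hpt]
  rcases eq_or_ne q ⊤ with rfl | hqt
  · simp only [ENNReal.div_top, tsub_zero, ENNReal.toReal_div, ENNReal.toReal_one]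
    refine Real.rpow_le_rpow (by positivity) ?_ (by positivity)
    calc ∑ i, |x i| ^ p.toReal ≤ ∑ _i : ι, (1 : ℝ) :=
          Finset.sum_le_sum fun i _ => Real.rpow_le_one (abs_nonneg _)
            ((abs_apply_le_pNorm hq1 x i).trans hx.le) hp0.le
      _ = Fintype.card ι := by simp
  · have hpq' : p.toReal ≤ q.toReal := ENNReal.toReal_mono hqt hpq
    have hq0 : 0 < q.toReal := hp0.trans_le hpq'
    have hexp : (1 / p - 1 / q).toReal = 1 / p.toReal - 1 / q.toReal := by
      rw [ENNReal.toReal_sub_of_le (ENNReal.div_le_div_left hpq 1)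
        (by simpa using (zero_lt_one.trans_le hp).ne')]
      simp
    have hmean := Real.rpow_sum_le_const_mul_sum_rpow_of_nonneg Finset.univ
      (f := fun i => |x i| ^ p.toReal) ((one_le_div hp0).mpr hpq') fun i _ => by positivity
    have hterm (i : ι) : (|x i| ^ p.toReal) ^ (q.toReal / p.toReal) = |x i| ^ q.toReal := by
      rw [← Real.rpow_mul (abs_nonneg _), mul_div_cancel₀ _ hp0.ne']
    simp only [hterm, sum_rpow_eq_one hq1 hqt hx, mul_one, Finset.card_univ] at hmean
    have hroot := Real.rpow_le_rpow (by positivity) hmean (one_div_nonneg.mpr hq0.le)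
    rw [← Real.rpow_mul (by positivity), ← Real.rpow_mul (by positivity)] at hroot
    rw [hexp]
    convert hroot using 2 <;> field_simp

end pNorm

section opNormP

variable {k : ℕ} {p : ℝ≥0∞} {d : Fin k → ℕ} {A : ((n : Fin k) → Fin (d n)) → ℝ}

theorem apply_le_opNormP (hp : 1 ≤ p) {x : (n : Fin k) → Fin (d n) → ℝ}
    (hx : ∀ n, pNorm p (x n) = 1) :
    ∑ i : (n : Fin k) → Fin (d n), A i * ∏ n, x n (i n) ≤ opNormP p d A := by
  refine le_csSup ⟨∑ i, |A i|, ?_⟩ ⟨x, hx, rfl⟩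
  rintro _ ⟨y, hy, rfl⟩
  refine Finset.sum_le_sum fun i _ => (le_abs_self _).trans ?_
  rw [abs_mul, Finset.abs_prod]
  exact mul_le_of_le_one_right (abs_nonneg _) (Finset.prod_le_one (fun _ _ => abs_nonneg _)
    fun n _ => (abs_apply_le_pNorm hp (y n) (i n)).trans (hy n).le)

theorem opNormP_nonneg (hk : 0 < k) (hp : 1 ≤ p) : 0 ≤ opNormP p d A := by
  by_cases h : ∃ x : (n : Fin k) → Fin (d n) → ℝ, ∀ n, pNorm p (x n) = 1
  · obtain ⟨x, hx⟩ := h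
    let m : Fin k := ⟨0, hk⟩
    let s : Fin k → ℝ := fun n => if n = m then -1 else 1
    have hs : ∏ n, s n = -1 := by simp [s]
    have hneg := apply_le_opNormP (A := A) hp (x := fun n => s n • x n) fun n => by
      rw [pNorm_smul hp, hx n]
      by_cases hn : n = m <;> simp [s, hn]
    simp only [Pi.smul_apply, smul_eq_mul, Finset.prod_mul_distrib, hs, neg_mul, one_mul,
      mul_neg, Finset.sum_neg_distrib] at hneg
    linarith [apply_le_opNormP (A := A) hp hx]
  · refine Real.sSup_nonneg ?_
    rintro _ ⟨x, hx, _⟩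
    exact absurd ⟨x, hx⟩ h

theorem apply_le_prod_mul_opNormP (hk : 0 < k) (hp : 1 ≤ p)
    {x : (n : Fin k) → Fin (d n) → ℝ} (hx : ∀ n, x n ≠ 0) {c : Fin k → ℝ}
    (hc : ∀ n, pNorm p (x n) ≤ c n) :
    ∑ i : (n : Fin k) → Fin (d n), A i * ∏ n, x n (i n) ≤ (∏ n, c n) * opNormP p d A := by
  have hpos (n : Fin k) : 0 < pNorm p (x n) := pNorm_pos hp (hx n)
  have hP : 0 < ∏ n, pNorm p (x n) := Finset.prod_pos fun n _ => hpos n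
  have hunit := apply_le_opNormP (A := A) hp (x := fun n => (pNorm p (x n))⁻¹ • x n) fun n => by
    rw [pNorm_smul hp, abs_of_pos (inv_pos.mpr (hpos n)), inv_mul_cancel₀ (hpos n).ne']
  simp only [Pi.smul_apply, smul_eq_mul, Finset.prod_mul_distrib, Finset.prod_inv_distrib,
    mul_left_comm (A _), ← Finset.mul_sum] at hunit
  rw [inv_mul_le_iff₀ hP] at hunit
  exact hunit.trans (mul_le_mul_of_nonneg_right
    (Finset.prod_le_prod (fun n _ => (hpos n).le) fun n _ => hc n) (opNormP_nonneg hk hp))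

theorem opNormP_le_prod_mul_opNormP {q : ℝ≥0∞} (hk : 0 < k) (hp : 1 ≤ p) (hq : 1 ≤ q)
    {c : Fin k → ℝ} (hc0 : ∀ n, 0 ≤ c n)
    (hc : ∀ n (x : Fin (d n) → ℝ), pNorm q x = 1 → pNorm p x ≤ c n) :
    opNormP q d A ≤ (∏ n, c n) * opNormP p d A := by
  refine Real.sSup_le ?_ (mul_nonneg (Finset.prod_nonneg fun n _ => hc0 n) (opNormP_nonneg hk hp))
  rintro _ ⟨x, hx, rfl⟩
  exact apply_le_prod_mul_opNormP hk hp (fun n => ne_zero_of_pNorm_eq_one hq (hx n))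
    fun n => hc n (x n) (hx n)

end opNormP

end TensorUnfolding

open TensorUnfolding in
/-- For an order-`k` real tensor `A` with dimensions `(d₁, …, d_k)`
and `1 ≤ p ≤ q ≤ ∞` (with `1/∞ = 0`),
`‖A‖_p ≤ ‖A‖_q ≤ dim(A)^(1/p − 1/q) · ‖A‖_p`. -/
theorem lp_norm_vs_lq_norm {k : ℕ} (d : Fin k → ℕ) (hd : ∀ n, 1 ≤ d n)
    (A : ((n : Fin k) → Fin (d n)) → ℝ)
    (p q : ℝ≥0∞) (hp : 1 ≤ p) (hpq : p ≤ q) :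
    opNormP p d A ≤ opNormP q d A ∧
    opNormP q d A ≤
      (∏ n : Fin k, (d n : ℝ)) ^ (1 / p - 1 / q).toReal * opNormP p d A := by
  have hq : 1 ≤ q := hp.trans hpq
  rcases Nat.eq_zero_or_pos k with rfl | hk
  · simp [opNormP]
  constructor
  · simpa using opNormP_le_prod_mul_opNormP (A := A) hk hq hp (c := fun _ => 1)
      (fun _ => zero_le_one) fun n x hx => pNorm_le_one_of_le hp hpq hx
  · rw [← Real.finsetProd_rpow _ _ fun n _ => Nat.cast_nonneg (d n)]
    exact opNormP_le_prod_mul_opNormP hk hp hq (fun n => by positivity)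
      fun n x hx => by simpa using pNorm_le_card_rpow hp hpq hx
end

section
/- Let A be an order-k real tensor with dimensions (d₁,…,d_k) and let π₁, π₂ be partitions of [k] with π₁ ≤ π₂ (π₁ refines π₂). Then ‖Unfold_{π₁}(A)‖_σ ≤ ‖Unfold_{π₂}(A)‖_σ. -/
open scoped BigOperators ENNReal

namespace TensorUnfolding

/-- Two blocks of a partition that share an element are equal. -/
theorem IsPartition.eq_of_mem {k : ℕ} {π : Finset (Finset (Fin k))} (h : IsPartition π)
    {B B' : Finset (Fin k)} (hB : B ∈ π) (hB' : B' ∈ π) {j : Fin k} (hj : j ∈ B)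
    (hj' : j ∈ B') : B = B' := by
  by_contra hne
  exact Finset.disjoint_left.mp (h.2.1 B hB B' hB' hne) hj hj'

/-- The blocks of a partition cover the index set. -/
theorem IsPartition.exists_mem {k : ℕ} {π : Finset (Finset (Fin k))} (h : IsPartition π)
    (j : Fin k) : ∃ B ∈ π, j ∈ B := by
  have hj : j ∈ π.sup id := h.2.2 ▸ Finset.mem_univ j
  simpa [Finset.mem_sup] using hj

/-- Fubini for a product of functions of disjoint groups of coordinates: if the members of `S`
are pairwise disjoint with union `B`, then the sum over all points indexed by `B` factors. -/
theorem sum_prod_restrict {α : Type*} {β : α → Type*} [DecidableEq α] [∀ j, Fintype (β j)]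
    {R : Type*} [CommSemiring R]
    {B : Finset α} {S : Finset (Finset α)} (hsub : ∀ C ∈ S, C ⊆ B)
    (hdisj : ∀ C ∈ S, ∀ C' ∈ S, ∀ j ∈ C, j ∈ C' → C = C')
    (hcov : ∀ j ∈ B, ∃ C ∈ S, j ∈ C) (f : (C : Finset α) → ((j : C) → β j.1) → R) :
    ∑ v : (j : B) → β j.1, ∏ C : S, f C.1 (fun j => v ⟨j.1, hsub C.1 C.2 j.2⟩) =
      ∏ C ∈ S, ∑ w, f C w := by
  have hbij : Function.Bijective fun (v : (j : B) → β j.1) (C : S) (j : C.1) =>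
      v ⟨j.1, hsub C.1 C.2 j.2⟩ := by
    constructor
    · intro v v' hv
      funext ⟨j, hj⟩
      obtain ⟨C, hC, hjC⟩ := hcov j hj
      exact congrFun (congrFun hv ⟨C, hC⟩) ⟨j, hjC⟩
    · intro w
      choose c hc hjc using hcov
      refine ⟨fun j => w ⟨c j.1 j.2, hc _ _⟩ ⟨j.1, hjc _ _⟩, ?_⟩
      funext ⟨C, hC⟩ ⟨j, hj⟩
      have key : ∀ (C' : Finset α) (hC' : C' ∈ S) (hj' : j ∈ C'), C = C' →
          w ⟨C', hC'⟩ ⟨j, hj'⟩ = w ⟨C, hC⟩ ⟨j, hj⟩ := by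
        rintro _ _ _ rfl
        rfl
      exact key _ _ _ (hdisj _ hC _ (hc _ _) j hj (hjc _ _))
  rw [← Finset.prod_coe_sort S (fun C => ∑ w, f C w), Finset.prod_univ_sum,
    Fintype.piFinset_univ]
  exact hbij.sum_comp fun x => ∏ C : S, f C.1 (x C)

/-- The values whose supremum is the spectral norm of an unfolding are bounded above. -/
theorem bddAbove_unfoldNorm {k : ℕ} (d : Fin k → ℕ)
    (A : ((n : Fin k) → Fin (d n)) → ℝ) (π : Finset (Finset (Fin k))) :
    BddAbove { r : ℝ |
      ∃ y : (B : Finset (Fin k)) → ((j : B) → Fin (d j.1)) → ℝ,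
        (∀ B ∈ π, ∑ v, (y B v) ^ 2 = 1) ∧
        r = ∑ i : (n : Fin k) → Fin (d n), A i * ∏ B ∈ π, y B fun j => i j.1 } := by
  refine ⟨∑ i, |A i|, ?_⟩
  rintro _ ⟨y, hy, rfl⟩
  refine Finset.sum_le_sum fun i _ => (le_abs_self _).trans ?_
  rw [abs_mul, Finset.abs_prod]
  refine mul_le_of_le_one_right (abs_nonneg _)
    (Finset.prod_le_one (fun _ _ => abs_nonneg _) fun B hB => ?_)
  rw [← sq_le_one_iff_abs_le_one, ← hy B hB]
  exact Finset.single_le_sum (f := fun v => y B v ^ 2) (fun _ _ => sq_nonneg _)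
    (Finset.mem_univ _)

end TensorUnfolding

open TensorUnfolding in
/-- **Monotonicity.** If `π₁` refines `π₂`, then
`‖Unfold_{π₁}(A)‖_σ ≤ ‖Unfold_{π₂}(A)‖_σ`. -/
theorem unfoldNorm_monotone {k : ℕ} (d : Fin k → ℕ) (hd : ∀ n, 1 ≤ d n)
    (A : ((n : Fin k) → Fin (d n)) → ℝ)
    (π₁ π₂ : Finset (Finset (Fin k)))
    (h₁ : IsPartition π₁) (h₂ : IsPartition π₂) (hle : Refines π₁ π₂) :
    unfoldNorm d A π₁ ≤ unfoldNorm d A π₂ := by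
  refine csSup_le_csSup (bddAbove_unfoldNorm d A π₂) ?_ ?_
  · exact ⟨_, fun B => Pi.single (fun j => ⟨0, hd j.1⟩) 1,
      fun B _ => by simp [Pi.single_apply], rfl⟩
  rintro _ ⟨y, hy, rfl⟩
  have hsub : ∀ B, ∀ C ∈ π₁.filter (· ⊆ B), C ⊆ B := fun B C hC => (Finset.mem_filter.mp hC).2
  refine ⟨fun B v => ∏ C : π₁.filter (· ⊆ B), y C.1 fun j => v ⟨j.1, hsub B C.1 C.2 j.2⟩, ?_, ?_⟩
  · intro B hB
    simp only [← Finset.prod_pow]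
    refine (sum_prod_restrict (β := fun j => Fin (d j)) (hsub B) ?_ ?_ fun C w => y C w ^ 2).trans ?_
    rotate_left 2
    · exact Finset.prod_eq_one fun C hC => hy C (Finset.mem_filter.mp hC).1
    · intro C hC C' hC' j hj hj'
      exact h₁.eq_of_mem (Finset.mem_filter.mp hC).1 (Finset.mem_filter.mp hC').1 hj hj'
    · intro j hj
      obtain ⟨C, hC, hjC⟩ := h₁.exists_mem j
      obtain ⟨B', hB', hCB'⟩ := hle C hC
      obtain rfl := h₂.eq_of_mem hB hB' hj (hCB' hjC)
      exact ⟨C, Finset.mem_filter.mpr ⟨hC, hCB'⟩, hjC⟩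
  · refine Finset.sum_congr rfl fun i _ => congrArg (A i * ·) ?_
    have hunion : π₂.biUnion (fun B => π₁.filter (· ⊆ B)) = π₁ := by
      ext C
      simp only [Finset.mem_biUnion, Finset.mem_filter]
      exact ⟨fun ⟨_, _, hC, _⟩ => hC, fun hC => (hle C hC).imp fun _ h => ⟨h.1, hC, h.2⟩⟩
    have hdisj : (π₂ : Set (Finset (Fin k))).PairwiseDisjoint
        fun B => π₁.filter (· ⊆ B) := by
      intro B hB B' hB' hne
      refine Finset.disjoint_left.mpr fun C hC hC' => hne ?_
      obtain ⟨j, hj⟩ := h₁.1 C (Finset.mem_filter.mp hC).1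
      exact h₂.eq_of_mem hB hB' (hsub B C hC hj) (hsub B' C hC' hj)
    calc ∏ C ∈ π₁, y C (fun j => i j.1)
        = ∏ B ∈ π₂, ∏ C ∈ π₁.filter (· ⊆ B), y C (fun j => i j.1) := by
          rw [← Finset.prod_biUnion hdisj, hunion]
      _ = _ := Finset.prod_congr rfl fun B _ => (Finset.prod_coe_sort _ _).symm
end

section
/- Let A be an order-k real tensor with dimensions (d₁,…,d_k), let π be a partition of [k] with at least two blocks, let B_i ≠ B_j be two blocks of π, and let π' be the partition obtained from π by merging B_i and B_j into the single block B_i ∪ B_j. Writing D_B = Π_{n∈B} d_n for the dimension of the unfolded mode corresponding to a block B, then min(D_{B_i}, D_{B_j})^{−1/2} · ‖Unfold_{π'}(A)‖_σ ≤ ‖Unfold_π(A)‖_σ ≤ ‖Unfold_{π'}(A)‖_σ. -/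
open scoped BigOperators ENNReal

namespace TensorUnfolding

variable {k : ℕ} {d : Fin k → ℕ} {A : ((n : Fin k) → Fin (d n)) → ℝ}
  {π : Finset (Finset (Fin k))} {B₁ B₂ : Finset (Fin k)}

/-- The values whose supremum is `unfoldNorm`. -/
def unfoldValues (d : Fin k → ℕ) (A : ((n : Fin k) → Fin (d n)) → ℝ)
    (π : Finset (Finset (Fin k))) : Set ℝ :=
  { r : ℝ |
    ∃ y : (B : Finset (Fin k)) → ((j : B) → Fin (d j.1)) → ℝ,
      (∀ B ∈ π, ∑ v, (y B v) ^ 2 = 1) ∧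
      r = ∑ i : (n : Fin k) → Fin (d n), A i * ∏ B ∈ π, y B fun j => i j.1 }

lemma unfoldNorm_eq_sSup : unfoldNorm d A π = sSup (unfoldValues d A π) := rfl

lemma unfoldValues_nonempty (hd : ∀ n, 1 ≤ d n) : (unfoldValues d A π).Nonempty := by
  refine ⟨_, fun B => Pi.single (fun j => ⟨0, hd j.1⟩) 1, fun B _ => ?_, rfl⟩
  rw [Finset.sum_eq_single (fun j : B => (⟨0, hd j.1⟩ : Fin (d j.1)))]
  · simp
  · intro v _ hv
    simp [Pi.single_eq_of_ne hv]
  · simp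

lemma bddAbove_unfoldValues : BddAbove (unfoldValues d A π) := by
  refine ⟨∑ i, |A i|, ?_⟩
  rintro r ⟨y, hy, rfl⟩
  refine Finset.sum_le_sum fun i _ => (le_abs_self _).trans ?_
  rw [abs_mul, Finset.abs_prod]
  refine mul_le_of_le_one_right (abs_nonneg _) (Finset.prod_le_one (fun _ _ => abs_nonneg _) ?_)
  intro B hB
  rw [← sq_le_one_iff_abs_le_one, ← hy B hB]
  exact Finset.single_le_sum (f := fun v => y B v ^ 2) (fun _ _ => sq_nonneg _)
    (Finset.mem_univ _)

lemma neg_mem_unfoldValues (hB : B₁ ∈ π) {r : ℝ} (hr : r ∈ unfoldValues d A π) :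
    -r ∈ unfoldValues d A π := by
  obtain ⟨y, hy, rfl⟩ := hr
  refine ⟨Function.update y B₁ (-y B₁), fun B hB' => ?_, ?_⟩
  · by_cases h : B = B₁
    · subst h
      simpa using hy B hB'
    · simpa [h] using hy B hB'
  · rw [← Finset.sum_neg_distrib]
    refine Finset.sum_congr rfl fun i _ => ?_
    have hrest : ∏ B ∈ π.erase B₁, Function.update y B₁ (-y B₁) B (fun j => i j.1) =
        ∏ B ∈ π.erase B₁, y B fun j => i j.1 :=
      Finset.prod_congr rfl fun B hB' => by
        rw [Function.update_of_ne (Finset.ne_of_mem_erase hB')]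
    rw [← Finset.mul_prod_erase π _ hB, ← Finset.mul_prod_erase π _ hB, hrest]
    simp

lemma unfoldNorm_nonneg (hd : ∀ n, 1 ≤ d n) (hB : B₁ ∈ π) : 0 ≤ unfoldNorm d A π := by
  obtain ⟨r, hr⟩ := unfoldValues_nonempty (A := A) (π := π) hd
  have h₁ := le_csSup bddAbove_unfoldValues hr
  have h₂ := le_csSup bddAbove_unfoldValues (neg_mem_unfoldValues hB hr)
  rw [unfoldNorm_eq_sSup]
  linarith

/-- Evaluation of the unfolding of `A`, with the vectors at `B₁` and `B₂` singled out. -/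
def evalPair (A : ((n : Fin k) → Fin (d n)) → ℝ) (π : Finset (Finset (Fin k)))
    (B₁ B₂ : Finset (Fin k)) (y : (B : Finset (Fin k)) → ((j : B) → Fin (d j.1)) → ℝ)
    (z : ((j : B₁) → Fin (d j.1)) → ℝ) (w : ((j : B₂) → Fin (d j.1)) → ℝ) : ℝ :=
  ∑ i : (n : Fin k) → Fin (d n), A i * ((z fun j => i j.1) * (w fun j => i j.1) *
    ∏ B ∈ (π.erase B₁).erase B₂, y B fun j => i j.1)

variable {y : (B : Finset (Fin k)) → ((j : B) → Fin (d j.1)) → ℝ}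
  {z : ((j : B₁) → Fin (d j.1)) → ℝ} {w : ((j : B₂) → Fin (d j.1)) → ℝ}

lemma prod_eq_mul_mul_prod_erase (hB₁ : B₁ ∈ π) (hB₂ : B₂ ∈ π) (hne : B₁ ≠ B₂)
    (f : Finset (Fin k) → ℝ) :
    ∏ B ∈ π, f B = f B₁ * f B₂ * ∏ B ∈ (π.erase B₁).erase B₂, f B := by
  rw [← Finset.mul_prod_erase π _ hB₁,
    ← Finset.mul_prod_erase (π.erase B₁) _ (Finset.mem_erase.2 ⟨hne.symm, hB₂⟩), mul_assoc]

lemma evalPair_le_unfoldNorm (hB₁ : B₁ ∈ π) (hB₂ : B₂ ∈ π) (hne : B₁ ≠ B₂)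
    (hy : ∀ B ∈ (π.erase B₁).erase B₂, ∑ v, y B v ^ 2 = 1)
    (hz : ∑ v, z v ^ 2 = 1) (hw : ∑ v, w v ^ 2 = 1) :
    evalPair A π B₁ B₂ y z w ≤ unfoldNorm d A π := by
  refine le_csSup bddAbove_unfoldValues
    ⟨Function.update (Function.update y B₁ z) B₂ w, fun B hB => ?_, ?_⟩
  · by_cases h₂ : B = B₂
    · subst h₂
      simpa using hw
    by_cases h₁ : B = B₁
    · subst h₁
      simpa [h₂] using hz
    · simpa [h₁, h₂] using hy B (by simp [h₁, h₂, hB])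
  · refine Finset.sum_congr rfl fun i _ => ?_
    rw [prod_eq_mul_mul_prod_erase hB₁ hB₂ hne, Function.update_self,
      Function.update_of_ne hne, Function.update_self]
    congr 2
    refine Finset.prod_congr rfl fun B hB => ?_
    simp only [Finset.mem_erase] at hB
    rw [Function.update_of_ne hB.1, Function.update_of_ne hB.2.1]

lemma evalPair_smul_right (c : ℝ) :
    evalPair A π B₁ B₂ y z (c • w) = c * evalPair A π B₁ B₂ y z w := by
  simp only [evalPair, Finset.mul_sum, Pi.smul_apply, smul_eq_mul]
  exact Finset.sum_congr rfl fun i _ => by ring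

lemma evalPair_le_sqrt_mul_unfoldNorm (hB₁ : B₁ ∈ π) (hB₂ : B₂ ∈ π) (hne : B₁ ≠ B₂)
    (hy : ∀ B ∈ (π.erase B₁).erase B₂, ∑ v, y B v ^ 2 = 1) (hz : ∑ v, z v ^ 2 = 1) :
    evalPair A π B₁ B₂ y z w ≤ √(∑ v, w v ^ 2) * unfoldNorm d A π := by
  rcases (Finset.sum_nonneg fun v _ => sq_nonneg (w v) :
    0 ≤ ∑ v, w v ^ 2).eq_or_lt' with h | h
  · have hw : w = (0 : ℝ) • w := by
      ext v
      have := (Finset.sum_eq_zero_iff_of_nonneg fun v _ => sq_nonneg (w v)).1 h v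
        (Finset.mem_univ v)
      simpa using this
    rw [h, hw, evalPair_smul_right]
    simp
  · set c := √(∑ v, w v ^ 2)
    have hc : 0 < c := Real.sqrt_pos.2 h
    have hc2 : c ^ 2 = ∑ v, w v ^ 2 := Real.sq_sqrt h.le
    have hw : w = c • c⁻¹ • w := by rw [smul_smul, mul_inv_cancel₀ hc.ne', one_smul]
    rw [hw, evalPair_smul_right]
    refine mul_le_mul_of_nonneg_left (evalPair_le_unfoldNorm hB₁ hB₂ hne hy hz ?_) hc.le
    simp only [Pi.smul_apply, smul_eq_mul, mul_pow, ← Finset.mul_sum, ← hc2]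
    rw [← mul_pow, inv_mul_cancel₀ hc.ne', one_pow]

lemma union_notMem_erase (hπ : IsPartition π) (hB₁ : B₁ ∈ π) :
    B₁ ∪ B₂ ∉ (π.erase B₁).erase B₂ := by
  intro h
  simp only [Finset.mem_erase] at h
  have hdisj := hπ.2.1 _ h.2.2 _ hB₁ h.2.1
  exact (hπ.1 _ hB₁).ne_empty
    (Finset.disjoint_self_iff_empty _ |>.1 (hdisj.mono_left Finset.subset_union_left))

lemma piFinsetUnion_restrict (h : Disjoint B₁ B₂) (i : (n : Fin k) → Fin (d n)) :
    Equiv.piFinsetUnion (fun n => Fin (d n)) h (fun j : B₁ => i j.1, fun j : B₂ => i j.1) =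
      fun j : (B₁ ∪ B₂ : Finset (Fin k)) => i j.1 := by
  rw [← Equiv.eq_symm_apply]
  rfl

lemma unfoldNorm_le_merge (hd : ∀ n, 1 ≤ d n) (hπ : IsPartition π) (hB₁ : B₁ ∈ π)
    (hB₂ : B₂ ∈ π) (hne : B₁ ≠ B₂) :
    unfoldNorm d A π ≤ unfoldNorm d A (insert (B₁ ∪ B₂) ((π.erase B₁).erase B₂)) := by
  have hdisj := hπ.2.1 _ hB₁ _ hB₂ hne
  have hU := union_notMem_erase (B₂ := B₂) hπ hB₁
  refine csSup_le (unfoldValues_nonempty hd) ?_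
  rintro r ⟨y, hy, rfl⟩
  let e := Equiv.piFinsetUnion (fun n => Fin (d n)) hdisj
  refine le_csSup bddAbove_unfoldValues
    ⟨Function.update y (B₁ ∪ B₂) fun v => y B₁ (e.symm v).1 * y B₂ (e.symm v).2, ?_, ?_⟩
  · intro B hB
    by_cases h : B = B₁ ∪ B₂
    · subst h
      rw [Function.update_self, ← e.sum_comp]
      simp only [Equiv.symm_apply_apply, mul_pow, Fintype.sum_prod_type]
      rw [← Fintype.sum_mul_sum, hy _ hB₁, hy _ hB₂, one_mul]
    · rw [Function.update_of_ne h]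
      simp only [Finset.mem_insert, h, Finset.mem_erase, false_or] at hB
      exact hy B hB.2.2
  · refine Finset.sum_congr rfl fun i _ => ?_
    rw [prod_eq_mul_mul_prod_erase hB₁ hB₂ hne, Finset.prod_insert hU, Function.update_self,
      ← piFinsetUnion_restrict hdisj, Equiv.symm_apply_apply]
    congr 2
    refine Finset.prod_congr rfl fun B hB => ?_
    rw [Function.update_of_ne (ne_of_mem_of_not_mem hB hU)]

lemma merge_le_sqrt_mul_unfoldNorm (hd : ∀ n, 1 ≤ d n) (hπ : IsPartition π) (hB₁ : B₁ ∈ π)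
    (hB₂ : B₂ ∈ π) (hne : B₁ ≠ B₂) :
    unfoldNorm d A (insert (B₁ ∪ B₂) ((π.erase B₁).erase B₂)) ≤
      √((∏ n ∈ B₁, d n : ℕ) : ℝ) * unfoldNorm d A π := by
  have hdisj := hπ.2.1 _ hB₁ _ hB₂ hne
  have hU := union_notMem_erase (B₂ := B₂) hπ hB₁
  refine csSup_le (unfoldValues_nonempty hd) ?_
  rintro r ⟨y, hy, rfl⟩
  let e := Equiv.piFinsetUnion (fun n => Fin (d n)) hdisj
  let Y : ((j : B₁) → Fin (d j.1)) → ((j : B₂) → Fin (d j.1)) → ℝ :=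
    fun u v => y (B₁ ∪ B₂) (e (u, v))
  have hY : ∑ u, ∑ v, Y u v ^ 2 = 1 := by
    rw [← hy _ (Finset.mem_insert_self _ _), ← e.sum_comp, Fintype.sum_prod_type]
  have hslices : ∑ i : (n : Fin k) → Fin (d n), A i *
      ∏ B ∈ insert (B₁ ∪ B₂) ((π.erase B₁).erase B₂), y B (fun j => i j.1) =
        ∑ u, evalPair A π B₁ B₂ y (Pi.single u 1) (Y u) := by
    simp only [evalPair]
    rw [Finset.sum_comm]
    refine Finset.sum_congr rfl fun i _ => ?_
    rw [← Finset.mul_sum, ← Finset.sum_mul, Finset.prod_insert hU,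
      Finset.sum_eq_single fun j : B₁ => i j.1]
    · rw [Pi.single_eq_same, one_mul, ← piFinsetUnion_restrict hdisj]
    · intro u _ hu
      rw [Pi.single_eq_of_ne hu.symm, zero_mul]
    · simp
  have hcard : (Fintype.card ((j : B₁) → Fin (d j.1)) : ℝ) = (∏ n ∈ B₁, d n : ℕ) := by
    rw [Fintype.card_pi, ← Finset.prod_coe_sort B₁ d]
    simp
  have hcs : ∑ u, √(∑ v, Y u v ^ 2) ≤ √((∏ n ∈ B₁, d n : ℕ) : ℝ) := by
    refine Real.le_sqrt_of_sq_le ?_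
    refine sq_sum_le_card_mul_sum_sq.trans_eq ?_
    rw [Finset.card_univ, hcard, Finset.sum_congr rfl fun u _ =>
      Real.sq_sqrt (Finset.sum_nonneg fun v _ => sq_nonneg (Y u v)), hY, mul_one]
  rw [hslices]
  refine le_trans (Finset.sum_le_sum fun u _ => evalPair_le_sqrt_mul_unfoldNorm hB₁ hB₂ hne
    (fun B hB => hy B (Finset.mem_insert_of_mem hB)) ?_) ?_
  · rw [Finset.sum_eq_single u]
    · simp
    · intro v _ hv
      simp [Pi.single_eq_of_ne hv]
    · simp
  · rw [← Finset.sum_mul]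
    exact mul_le_mul_of_nonneg_right hcs (unfoldNorm_nonneg hd hB₁)

end TensorUnfolding

open TensorUnfolding in
/-- **One-step inequality.** If `π'` is obtained from the partition
`π` by merging two distinct blocks `B₁, B₂ ∈ π`, then
`min(D_{B₁}, D_{B₂})^{-1/2} · ‖Unfold_{π'}(A)‖_σ ≤ ‖Unfold_π(A)‖_σ ≤ ‖Unfold_{π'}(A)‖_σ`,
where `D_B = Π_{n ∈ B} d_n`. -/
theorem one_step_inequality {k : ℕ} (d : Fin k → ℕ) (hd : ∀ n, 1 ≤ d n)
    (A : ((n : Fin k) → Fin (d n)) → ℝ)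
    (π : Finset (Finset (Fin k))) (hπ : IsPartition π)
    (B₁ B₂ : Finset (Fin k)) (hB₁ : B₁ ∈ π) (hB₂ : B₂ ∈ π) (hne : B₁ ≠ B₂) :
    ((min (∏ n ∈ B₁, d n) (∏ n ∈ B₂, d n) : ℕ) : ℝ) ^ (-(1 / 2) : ℝ) *
        unfoldNorm d A (insert (B₁ ∪ B₂) ((π.erase B₁).erase B₂)) ≤
      unfoldNorm d A π ∧
    unfoldNorm d A π ≤ unfoldNorm d A (insert (B₁ ∪ B₂) ((π.erase B₁).erase B₂)) := by
  refine ⟨?_, unfoldNorm_le_merge hd hπ hB₁ hB₂ hne⟩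
  have h₁ := merge_le_sqrt_mul_unfoldNorm (A := A) hd hπ hB₁ hB₂ hne
  have h₂ := merge_le_sqrt_mul_unfoldNorm (A := A) hd hπ hB₂ hB₁ hne.symm
  rw [Finset.union_comm, Finset.erase_right_comm] at h₂
  have hpos : (0 : ℝ) < (min (∏ n ∈ B₁, d n) (∏ n ∈ B₂, d n) : ℕ) := by
    exact_mod_cast lt_min (Finset.prod_pos fun n _ => hd n) (Finset.prod_pos fun n _ => hd n)
  rw [Real.rpow_neg hpos.le, ← Real.sqrt_eq_rpow, inv_mul_le_iff₀ (Real.sqrt_pos.2 hpos)]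
  rcases min_choice (∏ n ∈ B₁, d n) (∏ n ∈ B₂, d n) with h | h <;> rw [h] <;> assumption
end

section
/- Every order-k real tensor A with dimensions (d₁,…,d_k) satisfies ‖A‖_F ≤ [dim(A) / max_{n∈[k]} d_n]^{1/2} · ‖A‖_σ. -/
open scoped BigOperators ENNReal

namespace TensorUnfolding

lemma specNorm_bddAbove {k : ℕ} (d : Fin k → ℕ) (A : ((n : Fin k) → Fin (d n)) → ℝ) :
    BddAbove { r : ℝ | ∃ x : (n : Fin k) → Fin (d n) → ℝ,
      (∀ n, ∑ i, (x n i) ^ 2 = 1) ∧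
      r = ∑ i : (n : Fin k) → Fin (d n), A i * ∏ n, x n (i n) } := by
  refine ⟨∑ i, |A i|, ?_⟩
  rintro r ⟨x, hx, rfl⟩
  refine Finset.sum_le_sum fun i _ => ?_
  refine (le_abs_self _).trans ?_
  rw [abs_mul, Finset.abs_prod]
  refine mul_le_of_le_one_right (abs_nonneg _) ?_
  refine Finset.prod_le_one (fun _ _ => abs_nonneg _) fun n _ => ?_
  rw [← sq_le_one_iff_abs_le_one, ← hx n]
  exact Finset.single_le_sum (f := fun t => x n t ^ 2) (fun _ _ => sq_nonneg _)
    (Finset.mem_univ (i n))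

/-- Pairing a fiber of `A` with a unit vector is bounded by the spectral norm. -/
lemma fiber_inner_le_specNorm {k : ℕ} (d : Fin k → ℕ) (A : ((n : Fin k) → Fin (d n)) → ℝ)
    (m : Fin k) (i : (n : Fin k) → Fin (d n)) (w : Fin (d m) → ℝ) (hw : ∑ t, w t ^ 2 = 1) :
    ∑ t, A (Function.update i m t) * w t ≤ specNorm d A := by
  set x : (n : Fin k) → Fin (d n) → ℝ :=
    Function.update (fun n => Pi.single (i n) (1 : ℝ)) m w with hx
  have hxm : x m = w := by simp [hx]
  have hxn : ∀ n, n ≠ m → x n = Pi.single (i n) (1 : ℝ) := fun n hn => by simp [hx, hn]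
  refine le_csSup (specNorm_bddAbove d A) ⟨x, fun n => ?_, ?_⟩
  · by_cases hn : n = m
    · subst hn
      rwa [hxm]
    · simp [hxn n hn, Pi.single_apply]
  · refine Fintype.sum_of_injective (Function.update i m) (Function.update_injective i m) _ _
      (fun j hj => ?_) fun t => ?_
    · obtain ⟨n, hn, hne⟩ : ∃ n, n ≠ m ∧ j n ≠ i n := by
        by_contra! h
        refine hj ⟨j m, ?_⟩
        rw [Function.update_eq_iff]
        exact ⟨rfl, fun n hn => (h n hn).symm⟩
      rw [Finset.prod_eq_zero (Finset.mem_univ n), mul_zero]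
      simp [hxn n hn, hne]
    · congr 1
      rw [Fintype.prod_eq_single m fun n hn => by simp [hxn n hn, hn]]
      simp [hxm]

lemma specNorm_nonneg {k : ℕ} (d : Fin k → ℕ) (A : ((n : Fin k) → Fin (d n)) → ℝ)
    (m : Fin k) (i : (n : Fin k) → Fin (d n)) : 0 ≤ specNorm d A := by
  have h₁ := fiber_inner_le_specNorm d A m i (Pi.single (i m) 1) (by simp [Pi.single_apply])
  have h₂ := fiber_inner_le_specNorm d A m i (-Pi.single (i m) 1) (by simp [Pi.single_apply])
  simp only [Pi.neg_apply, mul_neg, Finset.sum_neg_distrib] at h₂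
  linarith

lemma sum_fiber_sq_le {k : ℕ} (d : Fin k → ℕ) (A : ((n : Fin k) → Fin (d n)) → ℝ)
    (m : Fin k) (i : (n : Fin k) → Fin (d n)) :
    ∑ t, A (Function.update i m t) ^ 2 ≤ specNorm d A ^ 2 := by
  set S := ∑ t, A (Function.update i m t) ^ 2 with hS
  have hS0 : 0 ≤ S := Finset.sum_nonneg fun _ _ => sq_nonneg _
  rcases hS0.eq_or_lt with h0 | hpos
  · rw [← h0]
    exact sq_nonneg _
  · have hle := fiber_inner_le_specNorm d A m i (fun t => A (Function.update i m t) / √S) (by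
      simp only [div_pow, Real.sq_sqrt hS0, ← Finset.sum_div, ← hS]
      exact div_self hpos.ne')
    simp only [← mul_div_assoc, ← pow_two, ← Finset.sum_div, ← hS, Real.div_sqrt] at hle
    exact (Real.sqrt_le_left (specNorm_nonneg d A m i)).mp hle

lemma sum_sum_update {k : ℕ} (d : Fin k → ℕ) (f : ((n : Fin k) → Fin (d n)) → ℝ)
    (m : Fin k) : ∑ i, ∑ t, f (Function.update i m t) = d m * ∑ i, f i := by
  have hinv : Function.Involutive fun p : ((n : Fin k) → Fin (d n)) × Fin (d m) =>
      (Function.update p.1 m p.2, p.1 m) := fun p => by simp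
  rw [← Fintype.sum_prod_type']
  refine (Equiv.sum_comp hinv.toPerm fun p => f p.1).trans ?_
  rw [Fintype.sum_prod_type]
  simp [Finset.mul_sum]

end TensorUnfolding

open TensorUnfolding in
/-- Every order-`k` real tensor `A` with dimensions
`(d₁, …, d_k)` satisfies `‖A‖_F ≤ [dim(A) / max_n d_n]^{1/2} · ‖A‖_σ`. -/
theorem frobNorm_le_specNorm {k : ℕ} (hk : 0 < k) (d : Fin k → ℕ) (hd : ∀ n, 1 ≤ d n)
    (A : ((n : Fin k) → Fin (d n)) → ℝ) :
    frobNorm d A ≤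
      ((∏ n : Fin k, (d n : ℝ)) / ((Finset.univ.sup d : ℕ) : ℝ)) ^ ((1 : ℝ) / 2) *
        specNorm d A := by
  obtain ⟨m, -, hm⟩ :=
    Finset.exists_mem_eq_sup Finset.univ ⟨(⟨0, hk⟩ : Fin k), Finset.mem_univ _⟩ d
  have hσ := specNorm_nonneg d A m fun n => ⟨0, hd n⟩
  have hdm : (0 : ℝ) < d m := by exact_mod_cast hd m
  have hsum : (d m : ℝ) * ∑ i, A i ^ 2 ≤ (∏ n, (d n : ℝ)) * specNorm d A ^ 2 := by
    rw [← sum_sum_update d (fun i => A i ^ 2) m]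
    refine (Finset.sum_le_sum fun i _ => sum_fiber_sq_le d A m i).trans_eq ?_
    simp
  rw [hm, ← Real.sqrt_eq_rpow, frobNorm]
  refine Real.sqrt_le_iff.mpr ⟨mul_nonneg (Real.sqrt_nonneg _) hσ, ?_⟩
  rw [mul_pow, Real.sq_sqrt (by positivity), div_mul_eq_mul_div, le_div_iff₀ hdm, mul_comm]
  exact hsum
end
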